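/- arXiv:1811.09754 — 6 statements merged into one kernel-verified Lean document; each statement's English description precedes it below -/
import Mathlib

section
/- For all integers k, l ≥ 1, the odd basis functions are orthonormal with respect to the weighted inner product: (1/(4π)) ∫_{-π}^{π} (d/dθ ẽ_k^{(o)}(θ)) (d/dθ ẽ_l^{(o)}(θ)) / sin²(θ/2) dθ = 1 if k = l and = 0 if k ≠ l. -/
open Real intervalIntegral

/-- The odd basis functions `ẽ_k^{(o)}(θ) = sin((k+1)θ)/(k+1) − sin(kθ)/k`. -/
noncomputable def eOdd (k : ℕ) : ℝ → ℝ :=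
  fun θ => Real.sin (((k : ℝ) + 1) * θ) / ((k : ℝ) + 1) - Real.sin ((k : ℝ) * θ) / (k : ℝ)

theorem deriv_eOdd {k : ℕ} (hk : 1 ≤ k) (θ : ℝ) :
    deriv (eOdd k) θ = -2 * Real.sin (((k : ℝ) + 1 / 2) * θ) * Real.sin (θ / 2) := by
  have hk0 : (k : ℝ) ≠ 0 := by positivity
  have hk1 : (k : ℝ) + 1 ≠ 0 := by positivity
  have hsin (c : ℝ) (hc : c ≠ 0) :
      HasDerivAt (fun x => Real.sin (c * x) / c) (Real.cos (c * θ)) θ := by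
    have h := (((hasDerivAt_id θ).const_mul c).sin).div_const c
    simpa [hc] using h
  have h : HasDerivAt (eOdd k) (Real.cos (((k : ℝ) + 1) * θ) - Real.cos ((k : ℝ) * θ)) θ :=
    (hsin _ hk1).sub (hsin _ hk0)
  rw [h.deriv, Real.cos_sub_cos]
  ring_nf

theorem integral_cos_int_mul (m : ℤ) :
    ∫ θ in (-Real.pi)..Real.pi, Real.cos ((m : ℝ) * θ) = if m = 0 then 2 * Real.pi else 0 := by
  split_ifs with hm
  · simp [hm]
    ring
  · have hm' : (m : ℝ) ≠ 0 := by exact_mod_cast hm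
    rw [intervalIntegral.integral_comp_mul_left (fun x => Real.cos x) hm', integral_cos]
    simp [Real.sin_int_mul_pi]

/-- Away from `θ = 0` the weight cancels against the derivatives. -/
theorem deriv_eOdd_mul_deriv_eOdd_div {k l : ℕ} (hk : 1 ≤ k) (hl : 1 ≤ l) {θ : ℝ}
    (hθ : Real.sin (θ / 2) ≠ 0) :
    deriv (eOdd k) θ * deriv (eOdd l) θ / Real.sin (θ / 2) ^ 2 =
      2 * Real.cos (((k - l : ℤ) : ℝ) * θ) - 2 * Real.cos (((k + l + 1 : ℤ) : ℝ) * θ) := by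
  have h1 : ((k - l : ℤ) : ℝ) * θ = ((k : ℝ) + 1 / 2) * θ - ((l : ℝ) + 1 / 2) * θ := by
    push_cast; ring
  have h2 : ((k + l + 1 : ℤ) : ℝ) * θ = ((k : ℝ) + 1 / 2) * θ + ((l : ℝ) + 1 / 2) * θ := by
    push_cast; ring
  rw [deriv_eOdd hk, deriv_eOdd hl, h1, h2, Real.cos_sub, Real.cos_add]
  field_simp
  ring

/-- Orthonormality of the odd basis functions with respect to the weighted inner product
`⟨ξ, η⟩_g = (1/(4π)) ∫_{-π}^{π} ξ'(θ) η'(θ) / sin²(θ/2) dθ`. -/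
theorem odd_basis_orthonormal (k l : ℕ) (hk : 1 ≤ k) (hl : 1 ≤ l) :
    (1 / (4 * Real.pi)) *
      ∫ θ in (-Real.pi)..Real.pi,
        deriv (eOdd k) θ * deriv (eOdd l) θ / Real.sin (θ / 2) ^ 2 =
    if k = l then 1 else 0 := by
  have hpi := Real.pi_pos
  have hcongr : ∫ θ in (-Real.pi)..Real.pi,
        deriv (eOdd k) θ * deriv (eOdd l) θ / Real.sin (θ / 2) ^ 2 =
      ∫ θ in (-Real.pi)..Real.pi, (2 * Real.cos (((k - l : ℤ) : ℝ) * θ) -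
        2 * Real.cos (((k + l + 1 : ℤ) : ℝ) * θ)) := by
    refine intervalIntegral.integral_congr_ae ?_
    filter_upwards [MeasureTheory.Measure.ae_ne MeasureTheory.volume (0 : ℝ)] with θ hθ hmem
    rw [Set.uIoc_of_le (by linarith)] at hmem
    refine deriv_eOdd_mul_deriv_eOdd_div hk hl fun h => hθ ?_
    have := (Real.sin_eq_zero_iff_of_lt_of_lt (by linarith [hmem.1]) (by linarith [hmem.2])).1 h
    linarith
  rw [hcongr, intervalIntegral.integral_sub
    (Continuous.intervalIntegrable (by fun_prop) _ _)
    (Continuous.intervalIntegrable (by fun_prop) _ _),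
    intervalIntegral.integral_const_mul, intervalIntegral.integral_const_mul,
    integral_cos_int_mul, integral_cos_int_mul, if_neg (show (k + l + 1 : ℤ) ≠ 0 by omega)]
  by_cases h : k = l
  · rw [if_pos h, if_pos (show (k - l : ℤ) = 0 by omega)]
    field_simp
    ring
  · rw [if_neg h, if_neg (show (k - l : ℤ) ≠ 0 by omega)]
    ring
end

section
/- Let (a_k)_{k≥1} be a finitely supported sequence of real numbers and set a_0 = 0. Then Σ_{k≥1} a_k·(−d_k a_{k−1} − (d_{k+1} − d_k) a_k + d_{k+1} a_{k+1}) = −Σ_{k≥1} (d_{k+1} − d_k) a_k², and this quantity is at most −(3/8) Σ_{k≥1} a_k². -/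
open Real

/-- The tridiagonal coefficients `d_k = (k−1)²(k+1)/(2k²)`. -/
noncomputable def dCoef (k : ℕ) : ℝ :=
  ((k : ℝ) - 1) ^ 2 * ((k : ℝ) + 1) / (2 * (k : ℝ) ^ 2)

/-- The gap `3/8 ≤ d_{k+1} − d_k` for `k ≥ 1`, written with the shift `k ↦ k+1`. -/
theorem three_eighths_le_dCoef_sub (k : ℕ) : 3 / 8 ≤ dCoef (k + 2) - dCoef (k + 1) := by
  have h : dCoef (k + 2) - dCoef (k + 1) - 3 / 8 =
      ((k : ℝ) ^ 4 + 6 * k ^ 3 + 17 * k ^ 2 + 16 * k) /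
        (8 * ((k : ℝ) + 1) ^ 2 * ((k : ℝ) + 2) ^ 2) := by
    have h1 : (k : ℝ) + 1 ≠ 0 := by positivity
    have h2 : (k : ℝ) + 2 ≠ 0 := by positivity
    simp only [dCoef]
    push_cast
    field_simp
    ring
  rw [← sub_nonneg, h]
  positivity

/-- For a finitely supported sequence `(a_k)_{k≥1}` with `a_0 = 0`:
`Σ_{k≥1} a_k (−d_k a_{k−1} − (d_{k+1} − d_k) a_k + d_{k+1} a_{k+1})
  = −Σ_{k≥1} (d_{k+1} − d_k) a_k² ≤ −(3/8) Σ_{k≥1} a_k²`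
(the sums over `k ≥ 1` are written with the shift `k ↦ k+1`). -/
theorem tridiagonal_quadratic_form (a : ℕ → ℝ) (h0 : a 0 = 0)
    (hfin : (Function.support a).Finite) :
    (∑' k : ℕ, a (k + 1) *
        (-(dCoef (k + 1)) * a k - (dCoef (k + 2) - dCoef (k + 1)) * a (k + 1) +
          dCoef (k + 2) * a (k + 2)) =
      -∑' k : ℕ, (dCoef (k + 2) - dCoef (k + 1)) * a (k + 1) ^ 2) ∧
    -∑' k : ℕ, (dCoef (k + 2) - dCoef (k + 1)) * a (k + 1) ^ 2 ≤
      -(3 / 8) * ∑' k : ℕ, a (k + 1) ^ 2 := by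
  obtain ⟨N, hN⟩ := hfin.bddAbove
  have hz : ∀ k, N < k → a k = 0 := fun k hk => by
    by_contra h
    exact hk.not_ge (hN h)
  have hz' : ∀ k ∉ Finset.range N, a (k + 1) = 0 := fun k hk =>
    hz _ (by rw [Finset.mem_range] at hk; omega)
  rw [tsum_eq_sum (s := Finset.range N) fun k hk => by rw [hz' k hk, zero_mul],
    tsum_eq_sum (s := Finset.range N)
      (f := fun k => (dCoef (k + 2) - dCoef (k + 1)) * a (k + 1) ^ 2)
      fun k hk => by simp [hz' k hk],
    tsum_eq_sum (s := Finset.range N) (f := fun k => a (k + 1) ^ 2)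
      fun k hk => by simp [hz' k hk]]
  constructor
  · have htel := Finset.sum_range_sub (fun k => dCoef (k + 1) * a k * a (k + 1)) N
    rw [h0, hz (N + 1) N.lt_succ_self, mul_zero, mul_zero, zero_mul, sub_zero] at htel
    rw [← zero_sub, ← htel, ← Finset.sum_sub_distrib]
    exact Finset.sum_congr rfl fun k _ => by ring
  · rw [neg_mul, neg_le_neg_iff, Finset.mul_sum]
    exact Finset.sum_le_sum fun k _ =>
      mul_le_mul_of_nonneg_right (three_eighths_le_dCoef_sub k) (sq_nonneg _)
end

section
/- Define F_m(θ) = −m sin θ cos(mθ) + cos θ sin(mθ) + sin θ cos(mθ) − (1/m) cos θ sin(mθ) for integers m ≥ 1. Then for every integer k ≥ 1 and every real θ: F_{k+1}(θ)/(k+1) − F_k(θ)/k = −d_{k+1} ẽ_{k+1}^{(o)}(θ) − (d_{k+1} − d_k) ẽ_k^{(o)}(θ) + d_k ẽ_{k−1}^{(o)}(θ), where for k = 1 the last term d_1 ẽ_0^{(o)} is interpreted as 0 (since d_1 = 0). -/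
open Real

/-- `F_m` is the action of the linearized De Gregorio operator at `−sin θ` on `sin(mθ)`. -/
noncomputable def Fop (m : ℕ) (θ : ℝ) : ℝ :=
  -(m : ℝ) * Real.sin θ * Real.cos ((m : ℝ) * θ) +
    Real.cos θ * Real.sin ((m : ℝ) * θ) +
    Real.sin θ * Real.cos ((m : ℝ) * θ) -
    (1 / (m : ℝ)) * Real.cos θ * Real.sin ((m : ℝ) * θ)

/-- Dividing by the frequency, `F_m / m = -d_m (ẽ_m + ẽ_{m-1})`. -/
theorem Fop_div_eq (m : ℕ) (hm : 1 ≤ m) (θ : ℝ) :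
    Fop m θ / (m : ℝ) = -(dCoef m) * (eOdd m θ + eOdd (m - 1) θ) := by
  obtain rfl | ⟨n, rfl⟩ : m = 1 ∨ ∃ n, m = n + 2 := by
    rcases Nat.lt_or_ge m 2 with h | h
    · exact Or.inl (by omega)
    · exact Or.inr ⟨m - 2, by omega⟩
  · simp [Fop, dCoef]
  · have h1 : (n : ℝ) + 1 ≠ 0 := by positivity
    have h2 : (n : ℝ) + 2 ≠ 0 := by positivity
    have h3 : (n : ℝ) + 2 + 1 ≠ 0 := by positivity
    have hadd : sin (((n : ℝ) + 2 + 1) * θ) =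
        sin (((n : ℝ) + 2) * θ) * cos θ + cos (((n : ℝ) + 2) * θ) * sin θ := by
      rw [← sin_add]
      ring_nf
    have hsub : sin (((n : ℝ) + 1) * θ) =
        sin (((n : ℝ) + 2) * θ) * cos θ - cos (((n : ℝ) + 2) * θ) * sin θ := by
      rw [← sin_sub]
      ring_nf
    have hsucc : (n : ℝ) + 1 + 1 = n + 2 := by ring
    simp only [Fop, dCoef, eOdd, show n + 2 - 1 = n + 1 from rfl, Nat.cast_add, Nat.cast_one,
      Nat.cast_ofNat, hsucc, hadd, hsub]
    field_simp
    ring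

/-- Tridiagonal representation on the odd basis: for all `k ≥ 1`,
`F_{k+1}/(k+1) − F_k/k = −d_{k+1} ẽ_{k+1}^{(o)} − (d_{k+1} − d_k) ẽ_k^{(o)} + d_k ẽ_{k−1}^{(o)}`
(for `k = 1` the last term vanishes since `d_1 = 0`). -/
theorem L_eOdd_tridiagonal (k : ℕ) (hk : 1 ≤ k) (θ : ℝ) :
    Fop (k + 1) θ / ((k : ℝ) + 1) - Fop k θ / (k : ℝ) =
      -(dCoef (k + 1)) * eOdd (k + 1) θ - (dCoef (k + 1) - dCoef k) * eOdd k θ +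
        dCoef k * eOdd (k - 1) θ := by
  have hsucc := Fop_div_eq (k + 1) (Nat.le_add_left 1 k) θ
  rw [Nat.cast_succ, Nat.add_sub_cancel] at hsucc
  rw [hsucc, Fop_div_eq k hk θ]
  ring
end

section
/- Define G_m(θ) = m sin θ sin(mθ) + (1 − 1/m) cos θ (cos(mθ) − 1) − sin θ sin(mθ) for integers m ≥ 1. Then for every integer k ≥ 1 and every real θ: G_{k+1}(θ)/(k+1) − G_k(θ)/k = −d_{k+1} ẽ_{k+1}^{(e)}(θ) − (d_{k+1} − d_k) ẽ_k^{(e)}(θ) + d_k ẽ_{k−1}^{(e)}(θ) + ((k² − k − 1)/(k²(k+1)²)) (cos θ − 1), where for k = 1 the term d_1 ẽ_0^{(e)} is interpreted as 0 (since d_1 = 0). -/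
open Real

/-- The even basis functions: `ẽ_0^{(e)}(θ) = cos θ − 1` and, for `l ≥ 1`,
`ẽ_l^{(e)}(θ) = (cos((l+1)θ) − 1)/(l+1) − (cos(lθ) − 1)/l`. -/
noncomputable def eEven (l : ℕ) : ℝ → ℝ :=
  fun θ =>
    if l = 0 then Real.cos θ - 1
    else (Real.cos (((l : ℝ) + 1) * θ) - 1) / ((l : ℝ) + 1) -
      (Real.cos ((l : ℝ) * θ) - 1) / (l : ℝ)

/-- `G_m` is the action of the linearized De Gregorio operator at `−sin θ` on `cos(mθ) − 1`. -/
noncomputable def Gop (m : ℕ) (θ : ℝ) : ℝ :=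
  (m : ℝ) * Real.sin θ * Real.sin ((m : ℝ) * θ) +
    (1 - 1 / (m : ℝ)) * Real.cos θ * (Real.cos ((m : ℝ) * θ) - 1) -
    Real.sin θ * Real.sin ((m : ℝ) * θ)

/-- Product-to-sum form of `Gop`. -/
theorem Gop_eq_cos {m : ℕ} (hm : m ≠ 0) (θ : ℝ) :
    Gop m θ = ((m : ℝ) - 1) *
      (((m : ℝ) + 1) / (2 * m) * Real.cos (((m : ℝ) - 1) * θ) -
        ((m : ℝ) - 1) / (2 * m) * Real.cos (((m : ℝ) + 1) * θ) - Real.cos θ / m) := by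
  have hm' : (m : ℝ) ≠ 0 := Nat.cast_ne_zero.mpr hm
  rw [sub_mul _ _ θ, add_mul _ _ θ, one_mul, Real.cos_sub, Real.cos_add, Gop]
  field_simp
  ring

/-- Tridiagonal representation on the even basis: for all `k ≥ 1`,
`G_{k+1}/(k+1) − G_k/k = −d_{k+1} ẽ_{k+1}^{(e)} − (d_{k+1} − d_k) ẽ_k^{(e)} + d_k ẽ_{k−1}^{(e)}
  + ((k² − k − 1)/(k²(k+1)²)) (cos θ − 1)`
(for `k = 1` the term `d_1 ẽ_0^{(e)}` vanishes since `d_1 = 0`). -/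
theorem L_eEven_tridiagonal (k : ℕ) (hk : 1 ≤ k) (θ : ℝ) :
    Gop (k + 1) θ / ((k : ℝ) + 1) - Gop k θ / (k : ℝ) =
      -(dCoef (k + 1)) * eEven (k + 1) θ - (dCoef (k + 1) - dCoef k) * eEven k θ +
        dCoef k * eEven (k - 1) θ +
        (((k : ℝ) ^ 2 - (k : ℝ) - 1) / ((k : ℝ) ^ 2 * ((k : ℝ) + 1) ^ 2)) *
          (Real.cos θ - 1) := by
  obtain rfl | ⟨n, rfl⟩ : k = 1 ∨ ∃ n, k = n + 2 := by
    obtain rfl | h := hk.eq_or_lt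
    · exact Or.inl rfl
    · exact Or.inr ⟨k - 2, by omega⟩
  · rw [Gop_eq_cos (by norm_num), Gop_eq_cos (by norm_num)]
    norm_num [dCoef, eEven]
    ring_nf
  · have h₁ : (n : ℝ) + 1 ≠ 0 := by positivity
    have h₂ : (n : ℝ) + 2 ≠ 0 := by positivity
    have h₃ : (n : ℝ) + 3 ≠ 0 := by positivity
    have h₄ : (n : ℝ) + 4 ≠ 0 := by positivity
    rw [Gop_eq_cos (by omega), Gop_eq_cos (by omega), show n + 2 - 1 = n + 1 by omega]
    simp only [dCoef, eEven, Nat.add_eq_zero_iff, OfNat.ofNat_ne_zero, one_ne_zero, and_false,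
      if_false]
    push_cast
    rw [show (n : ℝ) + 2 + 1 + 1 = n + 4 by ring, show (n : ℝ) + 2 + 1 - 1 = n + 2 by ring,
      show (n : ℝ) + 2 + 1 = n + 3 by ring, show (n : ℝ) + 2 - 1 = n + 1 by ring,
      show (n : ℝ) + 1 + 1 = n + 2 by ring]
    generalize Real.cos (((n : ℝ) + 1) * θ) = a
    generalize Real.cos (((n : ℝ) + 2) * θ) = b
    generalize Real.cos (((n : ℝ) + 3) * θ) = c
    generalize Real.cos (((n : ℝ) + 4) * θ) = d
    field_simp
    ring
end

section
/- Decreasing weighted norm at the first excited state (core identity of Theorem 1.4): define A_k = −(k−2)²/(4k), B_k = (k+2)(k−2)/(4k), and weights g_k by g_1 = 1, g_4 = 1, and g_{k+2} = g_k · k²(k+4)/((k+2)(k−2)²) for every integer k ≥ 1 with k ≠ 2 (in particular g_3 = 5/3). Let (b_k)_{k≥1} be any finitely supported real sequence, and define c_1 = −(3/4) b_1 + (5/12) b_3, c_2 = (3/4) b_4, and c_k = A_{k−2} b_{k−2} + B_{k+2} b_{k+2} for k ≥ 3. Then Σ_{k ≥ 1, k ≠ 2} g_k b_k c_k = −(3/4)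 b_1². -/
open Real

/-- `A_k = −(k−2)²/(4k)`. -/
noncomputable def Acoef (k : ℕ) : ℝ := -(((k : ℝ) - 2) ^ 2) / (4 * (k : ℝ))

/-- `B_k = (k+2)(k−2)/(4k)`. -/
noncomputable def Bcoef (k : ℕ) : ℝ := ((k : ℝ) + 2) * ((k : ℝ) - 2) / (4 * (k : ℝ))

/-- The weights symmetrize the off-diagonal part: `g_{k+2} A_k = -g_k B_{k+2}`. -/
lemma weight_mul_Acoef {g : ℕ → ℝ} {k : ℕ} (hk : 1 ≤ k) (hk2 : k ≠ 2)
    (hg : g (k + 2) =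
      g k * ((k : ℝ) ^ 2 * ((k : ℝ) + 4)) / (((k : ℝ) + 2) * ((k : ℝ) - 2) ^ 2)) :
    g (k + 2) * Acoef k = -(g k * Bcoef (k + 2)) := by
  have h0 : (k : ℝ) ≠ 0 := by positivity
  have h1 : (k : ℝ) + 2 ≠ 0 := by positivity
  have h2 : (k : ℝ) - 2 ≠ 0 := sub_ne_zero.2 (by exact_mod_cast hk2)
  rw [hg, Acoef, Bcoef]
  push_cast
  field_simp
  ring

/-- Core identity of Theorem 1.4: with the weights `g_k` (`g_1 = g_4 = 1`,
`g_{k+2} = g_k k²(k+4)/((k+2)(k−2)²)` for `k ≥ 1`, `k ≠ 2`), for any finitely supported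
sequence `(b_k)_{k≥1}` and `c_1 = −(3/4)b_1 + (5/12)b_3`, `c_2 = (3/4)b_4`,
`c_k = A_{k−2} b_{k−2} + B_{k+2} b_{k+2}` for `k ≥ 3`, one has
`Σ_{k ≥ 1, k ≠ 2} g_k b_k c_k = −(3/4) b_1²`. -/
theorem L2_weighted_norm_identity (g b c : ℕ → ℝ)
    (hg1 : g 1 = 1) (hg4 : g 4 = 1)
    (hgrec : ∀ k : ℕ, 1 ≤ k → k ≠ 2 →
      g (k + 2) = g k * ((k : ℝ) ^ 2 * ((k : ℝ) + 4)) / (((k : ℝ) + 2) * ((k : ℝ) - 2) ^ 2))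
    (hbfin : (Function.support b).Finite)
    (hc1 : c 1 = -(3 / 4) * b 1 + (5 / 12) * b 3)
    (hc2 : c 2 = (3 / 4) * b 4)
    (hck : ∀ k : ℕ, 3 ≤ k → c k = Acoef (k - 2) * b (k - 2) + Bcoef (k + 2) * b (k + 2)) :
    ∑' k : ℕ, (if k = 0 ∨ k = 2 then 0 else g k * b k * c k) = -(3 / 4) * (b 1) ^ 2 := by
  set f : ℕ → ℝ := fun k ↦ if k = 0 ∨ k = 2 then 0 else g k * b k * c k with hf
  set T : ℕ → ℝ := fun k ↦ if k = 2 then 0 else g k * Bcoef (k + 2) * b k * b (k + 2) with hT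
  have hT1 : T 1 = 5 / 12 * b 1 * b 3 := by
    simp [hT, hg1, Bcoef]
    norm_num
  have hstep (n : ℕ) : f (n + 3) = T (n + 3) - T (n + 1) := by
    have hc := hck (n + 3) (by omega)
    rw [show n + 3 - 2 = n + 1 by omega] at hc
    by_cases hn : n = 1
    · subst hn
      have hA : Acoef 2 = 0 := by simp [Acoef]
      norm_num [hA] at hc
      simp [hf, hT, hc]
      ring
    · have hw := weight_mul_Acoef (by omega) (by omega) (hgrec (n + 1) (by omega) (by omega))
      simp only [hf, hT, if_neg (show ¬(n + 3 = 0 ∨ n + 3 = 2) by omega),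
        if_neg (show n + 3 ≠ 2 by omega), if_neg (show n + 1 ≠ 2 by omega), hc]
      linear_combination b (n + 3) * b (n + 1) * hw
  have hsum (n : ℕ) :
      ∑ k ∈ Finset.range (n + 3), f k = -(3 / 4) * b 1 ^ 2 + T (n + 1) + T (n + 2) := by
    induction n with
    | zero =>
      have hf1 : f 1 = b 1 * c 1 := by simp [hf, hg1]
      have hf0 : f 0 = 0 := by simp [hf]
      have hf2 : f 2 = 0 := by simp [hf]
      have hT2 : T 2 = 0 := by simp [hT]
      simp only [Finset.sum_range_succ, Finset.sum_range_zero, zero_add, hf0, hf1, hf2, hT1, hT2,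
        hc1]
      ring
    | succ n ih =>
      rw [show n + 1 + 3 = n + 3 + 1 by ring, Finset.sum_range_succ, ih, hstep]
      ring_nf
  obtain ⟨N, hN⟩ := hbfin.bddAbove
  have hb (k : ℕ) (hk : N < k) : b k = 0 := by
    by_contra h
    exact absurd (hN h) (not_le.2 hk)
  rw [tsum_eq_sum (s := Finset.range (N + 3)), hsum]
  · simp [hT, hb (N + 1) (by omega), hb (N + 2) (by omega)]
  · intro k hk
    simp [hb k (by simp at hk; omega)]
end

section
/- Cubic growth of the weights: with g_1 = 1, g_4 = 1, g_{k+2} = g_k · k²(k+4)/((k+2)(k−2)²) for every integer k ≥ 1 with k ≠ 2 (so g_3 = 5/3 and g_2 = 0 plays no role), there exist constants c > 0 and C > 0 such that c·k³ ≤ g_k ≤ C·k³ for every integer k ≥ 3. -/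
open Real

/-- One step of the recursion preserves the closed form `a (k - 2)² (k + 2)`. -/
lemma weight_closed_form_step {x a y : ℝ} (hx : 2 < x) (hy : y = a * ((x - 2) ^ 2 * (x + 2))) :
    y * (x ^ 2 * (x + 4)) / ((x + 2) * (x - 2) ^ 2)
      = a * ((x + 2 - 2) ^ 2 * (x + 2 + 2)) := by
  have h₁ : x - 2 ≠ 0 := by linarith
  have h₂ : x + 2 ≠ 0 := by linarith
  rw [hy]
  field_simp
  ring

/-- The closed form propagates along a parity class. -/
lemma weight_closed_form {g : ℕ → ℝ}
    (hgrec : ∀ k : ℕ, 1 ≤ k → k ≠ 2 →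
      g (k + 2) = g k * ((k : ℝ) ^ 2 * ((k : ℝ) + 4)) / (((k : ℝ) + 2) * ((k : ℝ) - 2) ^ 2))
    {n : ℕ} (hn : 3 ≤ n) {a : ℝ} (h : g n = a * (((n : ℝ) - 2) ^ 2 * ((n : ℝ) + 2))) (m : ℕ) :
    g (n + 2 * m) = a * ((((n + 2 * m : ℕ) : ℝ) - 2) ^ 2 * (((n + 2 * m : ℕ) : ℝ) + 2)) := by
  induction m with
  | zero => simpa using h
  | succ m ih =>
    have hx : (2 : ℝ) < ((n + 2 * m : ℕ) : ℝ) := by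
      exact_mod_cast (by omega : 2 < n + 2 * m)
    rw [show n + 2 * (m + 1) = (n + 2 * m) + 2 by ring, hgrec _ (by omega) (by omega),
      weight_closed_form_step hx ih, Nat.cast_add (n + 2 * m) 2, Nat.cast_ofNat]

/-- The cubic `(x - 2)² (x + 2)` is comparable to `x³` on `[3, ∞)`. -/
lemma cubic_comparable {x : ℝ} (hx : 3 ≤ x) :
    x ^ 3 / 9 ≤ (x - 2) ^ 2 * (x + 2) ∧ (x - 2) ^ 2 * (x + 2) ≤ x ^ 3 := by
  constructor
  · have h₁ : (x / 3) ^ 2 ≤ (x - 2) ^ 2 := pow_le_pow_left₀ (by linarith) (by linarith) 2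
    calc x ^ 3 / 9 = (x / 3) ^ 2 * x := by ring
      _ ≤ (x - 2) ^ 2 * (x + 2) := by gcongr; linarith
  · nlinarith

/-- Cubic growth of the weights `g_k` determined by `g_1 = g_4 = 1` and
`g_{k+2} = g_k k²(k+4)/((k+2)(k−2)²)` for `k ≥ 1`, `k ≠ 2`: there are constants
`0 < c`, `0 < C` with `c k³ ≤ g_k ≤ C k³` for all `k ≥ 3`. -/
theorem weights_cubic_growth (g : ℕ → ℝ)
    (hg1 : g 1 = 1) (hg4 : g 4 = 1)
    (hgrec : ∀ k : ℕ, 1 ≤ k → k ≠ 2 →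
      g (k + 2) = g k * ((k : ℝ) ^ 2 * ((k : ℝ) + 4)) / (((k : ℝ) + 2) * ((k : ℝ) - 2) ^ 2)) :
    ∃ c C : ℝ, 0 < c ∧ 0 < C ∧
      ∀ k : ℕ, 3 ≤ k → c * (k : ℝ) ^ 3 ≤ g k ∧ g k ≤ C * (k : ℝ) ^ 3 := by
  have hg3 : g 3 = 5 / 3 := by
    have := hgrec 1 le_rfl (by norm_num)
    norm_num [hg1] at this
    exact this
  have hodd := weight_closed_form hgrec (n := 3) (a := 1 / 3) le_rfl (by rw [hg3]; norm_num)
  have heven := weight_closed_form hgrec (n := 4) (a := 1 / 24) (by norm_num)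
    (by rw [hg4]; norm_num)
  refine ⟨1 / 216, 1 / 3, by norm_num, by norm_num, fun k hk => ?_⟩
  have hx : (3 : ℝ) ≤ k := by exact_mod_cast hk
  obtain ⟨hlow, hupp⟩ := cubic_comparable hx
  have hpos : (0 : ℝ) < (k : ℝ) ^ 3 := by positivity
  rcases Nat.even_or_odd k with ⟨j, hj⟩ | ⟨j, hj⟩
  · have h := heven (j - 2)
    rw [show 4 + 2 * (j - 2) = k by omega] at h
    constructor <;> linarith
  · have h := hodd (j - 1)
    rw [show 3 + 2 * (j - 1) = k by omega] at h
    constructor <;> linarith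
end
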